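/- arXiv:1709.03865 — 2 statements merged into one kernel-verified Lean document; each statement's English description precedes it below -/
import Mathlib

section
/- Let T be a tree. Then the nullity of A(T) equals |Supp(T)| − |Core(T)|, where Supp(T) is the support of the null space of A(T) and Core(T) = N(Supp(T)). -/
open scoped Classical

open SimpleGraph Matrix

noncomputable section

variable {V : Type*}

/-- The real adjacency matrix of a simple graph. -/
def adjMat [Fintype V] (G : SimpleGraph V) : Matrix V V ℝ :=
  Matrix.of fun a b => if G.Adj a b then (1 : ℝ) else 0

/-- Support of the null space of the adjacency matrix. -/
def suppSet [Fintype V] (G : SimpleGraph V) : Set V :=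
  {v | ∃ x : V → ℝ, adjMat G *ᵥ x = 0 ∧ x v ≠ 0}

/-- Core: the set of neighbors of supported vertices. -/
def coreSet [Fintype V] (G : SimpleGraph V) : Set V :=
  {v | ∃ u ∈ suppSet G, G.Adj u v}

/-- An S-tree: a tree in which the closed neighborhood of the support is everything. -/
def IsSTree [Fintype V] (G : SimpleGraph V) : Prop :=
  G.IsTree ∧ suppSet G ∪ coreSet G = Set.univ

/-- Nullity of a graph: dimension of the kernel of its adjacency matrix. -/
def nullity [Fintype V] (G : SimpleGraph V) : ℕ :=
  Module.finrank ℝ (LinearMap.ker (adjMat G).mulVecLin)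

/-- Rank of a graph: rank of its adjacency matrix. -/
def rankA [Fintype V] (G : SimpleGraph V) : ℕ :=
  (adjMat G).rank

/-- Matching number: the maximum cardinality of a matching. -/
def matchingNumber [Fintype V] (G : SimpleGraph V) : ℕ :=
  sSup {n | ∃ M : G.Subgraph, M.IsMatching ∧ M.edgeSet.ncard = n}

/-- The set of maximum matchings. -/
def maxMatchings [Fintype V] (G : SimpleGraph V) : Set G.Subgraph :=
  {M | M.IsMatching ∧ M.edgeSet.ncard = matchingNumber G}

/-- The number of maximum matchings. -/
def numMaxMatchings [Fintype V] (G : SimpleGraph V) : ℕ :=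
  (maxMatchings G).ncard

/-- Independence number. -/
def indepNumber [Fintype V] (G : SimpleGraph V) : ℕ :=
  sSup {n | ∃ s : Set V, (∀ a ∈ s, ∀ b ∈ s, ¬ G.Adj a b) ∧ s.ncard = n}

/-- In a tree, a vertex has at most one neighbor closer to a given root. -/
theorem SimpleGraph.IsTree.eq_of_adj_of_dist_eq_add_one {G : SimpleGraph V} (hT : G.IsTree)
    {r w a b : V} (ha : G.Adj a w) (hb : G.Adj b w) (hda : G.dist r w = G.dist r a + 1)
    (hdb : G.dist r w = G.dist r b + 1) : a = b := by
  obtain ⟨p, hp⟩ := hT.connected.exists_walk_length_eq_dist r a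
  obtain ⟨q, hq⟩ := hT.connected.exists_walk_length_eq_dist r b
  have hp' : (p.concat ha).IsPath :=
    Walk.isPath_of_length_eq_dist _ (by rw [Walk.length_concat, hp, hda])
  have hq' : (q.concat hb).IsPath :=
    Walk.isPath_of_length_eq_dist _ (by rw [Walk.length_concat, hq, hdb])
  have h := (hT.existsUnique_path r w).unique hp' hq'
  simpa using congrArg Walk.penultimate h

/-- A subgraph of a finite tree in which no vertex has exactly one neighbor has no edges. -/
theorem SimpleGraph.IsTree.eq_bot_of_le_of_forall_exists_ne_adj [Finite V] {G H : SimpleGraph V}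
    (hT : G.IsTree) (hle : H ≤ G) (hH : ∀ ⦃a b⦄, H.Adj a b → ∃ c, c ≠ b ∧ H.Adj a c) :
    H = ⊥ := by
  obtain ⟨r⟩ := hT.connected.nonempty
  by_contra hne
  obtain ⟨v, u, hvu⟩ := SimpleGraph.ne_bot_iff_exists_adj.mp hne
  obtain ⟨w, hw, hmax⟩ := Set.exists_max_image {a | ∃ b, H.Adj a b} (G.dist r)
    (Set.toFinite _) ⟨v, u, hvu⟩
  obtain ⟨a, ha⟩ := hw
  obtain ⟨b, hba, hb⟩ := hH ha
  have parent : ∀ c, H.Adj w c → G.dist r w = G.dist r c + 1 := fun c hc ↦ by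
    have := hT.dist_eq_dist_add_one_of_adj r (hle hc)
    have := hmax c ⟨w, hc.symm⟩
    lia
  exact hba (hT.eq_of_adj_of_dist_eq_add_one (hle hb).symm (hle ha).symm (parent b hb) (parent a ha))

section NullSpace

variable [Fintype V] {G : SimpleGraph V}

theorem adjMat_mulVec_apply (x : V → ℝ) (a : V) :
    (adjMat G *ᵥ x) a = ∑ b, if G.Adj a b then x b else 0 := by
  simp [adjMat, Matrix.mulVec, dotProduct]

theorem exists_ne_adj_of_adjMat_mulVec_eq_zero {x : V → ℝ} {a b : V}
    (hx : (adjMat G *ᵥ x) a = 0) (hab : G.Adj a b) (hb : x b ≠ 0) :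
    ∃ c, c ≠ b ∧ G.Adj a c ∧ x c ≠ 0 := by
  by_contra! h
  rw [adjMat_mulVec_apply, Finset.sum_eq_single b] at hx
  · simp [hab, hb] at hx
  · intro c _ hc
    split_ifs with hac
    exacts [h c hc hac, rfl]
  · simp

/-- A vector supported on the core of a tree whose image under the adjacency matrix vanishes on
the support of the null space is zero. -/
theorem SimpleGraph.IsTree.eq_zero_of_adjMat_mulVec_eq_zero_on_suppSet (hT : G.IsTree)
    {y : V → ℝ} (hy : ∀ v, y v ≠ 0 → v ∈ coreSet G)
    (hS : ∀ s ∈ suppSet G, (adjMat G *ᵥ y) s = 0) : y = 0 := by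
  let H : SimpleGraph V :=
    { Adj := fun u v ↦ G.Adj u v ∧ (u ∈ suppSet G ∧ y v ≠ 0 ∨ v ∈ suppSet G ∧ y u ≠ 0)
      symm := ⟨fun _ _ h ↦ ⟨h.1.symm, h.2.symm⟩⟩
      loopless := ⟨fun _ h ↦ h.1.ne rfl⟩ }
  have hH : H = ⊥ := by
    refine hT.eq_bot_of_le_of_forall_exists_ne_adj (fun _ _ h ↦ h.1) ?_
    rintro u v ⟨huv, ⟨hu, hv⟩ | ⟨⟨x, hx, hxv⟩, hu⟩⟩
    · obtain ⟨c, hc, huc, hyc⟩ := exists_ne_adj_of_adjMat_mulVec_eq_zero (hS u hu) huv hv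
      exact ⟨c, hc, huc, .inl ⟨hu, hyc⟩⟩
    · obtain ⟨c, hc, huc, hxc⟩ :=
        exists_ne_adj_of_adjMat_mulVec_eq_zero (congrFun hx u) huv hxv
      exact ⟨c, hc, huc, .inr ⟨⟨x, hx, hxc⟩, hu⟩⟩
  ext v
  by_contra hv
  obtain ⟨u, hu, huv⟩ := hy v hv
  have : H.Adj u v := ⟨huv, .inl ⟨hu, hv⟩⟩
  simp [hH] at this

theorem Matrix.submatrix_mulVec_restrict {l m n R : Type*} [Fintype n]
    [NonUnitalNonAssocSemiring R] (A : Matrix m n R) (f : l → m) (s : Set n) [Fintype s]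
    {x : n → R} (hx : ∀ j ∉ s, x j = 0) (i : l) :
    (A.submatrix f ((↑) : s → n) *ᵥ fun j ↦ x j) i = (A *ᵥ x) (f i) := by
  simp only [Matrix.mulVec, dotProduct, Matrix.submatrix_apply]
  rw [← Finset.sum_subtype (Finset.univ.filter (· ∈ s)) (by simp) fun j ↦ A (f i) j * x j]
  refine Finset.sum_filter_of_ne fun j _ h ↦ ?_
  contrapose! h
  rw [hx j h, mul_zero]

theorem exists_restrict_eq {α R : Type*} [Zero R] (s : Set α) (y : s → R) :
    ∃ x : α → R, (∀ a ∉ s, x a = 0) ∧ (fun a : s ↦ x a) = y :=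
  ⟨fun a ↦ if h : a ∈ s then y ⟨a, h⟩ else 0, fun a h ↦ by simp [h], by ext a; simp⟩

variable (G) in
/-- The block of the adjacency matrix with rows in the core and columns in the support. -/
def coreSuppBlock : Matrix (coreSet G) (suppSet G) ℝ :=
  (adjMat G).submatrix (↑) (↑)

theorem adjMat_transpose : (adjMat G)ᵀ = adjMat G := by
  ext a b
  simp [adjMat, G.adj_comm]

theorem SimpleGraph.IsTree.rank_coreSuppBlock (hT : G.IsTree) :
    (coreSuppBlock G).rank = (coreSet G).ncard := by
  rw [← Matrix.rank_transpose, Matrix.rank, LinearMap.finrank_range_of_inj,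
    Module.finrank_fintype_fun_eq_card, ← Nat.card_eq_fintype_card, Nat.card_coe_set_eq]
  refine (injective_iff_map_eq_zero _).mpr fun y hy ↦ ?_
  obtain ⟨x, hx, rfl⟩ := exists_restrict_eq _ y
  have hx0 : x = 0 := by
    refine hT.eq_zero_of_adjMat_mulVec_eq_zero_on_suppSet
      (fun v hv ↦ of_not_not (mt (hx v) hv)) fun s hs ↦ ?_
    have h := congrFun hy ⟨s, hs⟩
    rwa [Matrix.mulVecLin_apply, coreSuppBlock, Matrix.transpose_submatrix, adjMat_transpose,
      Matrix.submatrix_mulVec_restrict _ _ _ hx] at h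
  ext v
  simp [hx0]

variable (G) in
/-- Restriction to the support identifies the null space with the kernel of the core-support
block. -/
theorem finrank_ker_coreSuppBlock :
    Module.finrank ℝ (LinearMap.ker (coreSuppBlock G).mulVecLin) = nullity G := by
  have supp_zero {x : V → ℝ} (hx : adjMat G *ᵥ x = 0) (v : V) (hv : v ∉ suppSet G) : x v = 0 :=
    of_not_not fun h ↦ hv ⟨x, hx, h⟩
  let restrict := (LinearMap.funLeft ℝ ℝ ((↑) : suppSet G → V)).domRestrict
    (LinearMap.ker (adjMat G).mulVecLin)
  have hinj : Function.Injective restrict := by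
    refine (injective_iff_map_eq_zero _).mpr fun ⟨x, hx⟩ h ↦ ?_
    ext v
    by_cases hv : v ∈ suppSet G
    · exact congrFun h ⟨v, hv⟩
    · exact supp_zero hx v hv
  have hrange : LinearMap.range restrict = LinearMap.ker (coreSuppBlock G).mulVecLin := by
    ext y
    constructor
    · rintro ⟨⟨x, hx⟩, rfl⟩
      ext c
      exact (Matrix.submatrix_mulVec_restrict _ _ _ (supp_zero hx) c).trans (congrFun hx c)
    · intro hy
      obtain ⟨x, hx, rfl⟩ := exists_restrict_eq _ y
      refine ⟨⟨x, ?_⟩, rfl⟩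
      ext v
      by_cases hv : v ∈ coreSet G
      · exact (Matrix.submatrix_mulVec_restrict (adjMat G) ((↑) : coreSet G → V) _ hx
          ⟨v, hv⟩).symm.trans (congrFun hy ⟨v, hv⟩)
      · rw [Matrix.mulVecLin_apply, adjMat_mulVec_apply]
        refine Finset.sum_eq_zero fun b _ ↦ ?_
        split_ifs with hvb
        exacts [hx b fun hb ↦ hv ⟨b, hb, hvb.symm⟩, rfl]
  rw [← hrange, LinearMap.finrank_range_of_inj hinj, nullity]

end NullSpace

/-- For any tree `T`, the nullity of `A(T)` equals `|Supp(T)| − |Core(T)|`. -/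
theorem stmt2 [Fintype V] (G : SimpleGraph V) (hT : G.IsTree) :
    nullity G = (suppSet G).ncard - (coreSet G).ncard := by
  have h := LinearMap.finrank_range_add_finrank_ker (coreSuppBlock G).mulVecLin
  change (coreSuppBlock G).rank + _ = _ at h
  rw [hT.rank_coreSuppBlock, finrank_ker_coreSuppBlock, Module.finrank_fintype_fun_eq_card,
    ← Nat.card_eq_fintype_card, Nat.card_coe_set_eq] at h
  lia
end
end

section
/- Let S_1,...,S_k be S-trees and v_i ∈ Supp(S_i) a supported vertex of S_i for each i. Then the S-coalescence ⊛_{i=1}^k (S_i, v_i), obtained by identifying the vertices v_1,...,v_k into a single new vertex v*, is again an S-tree. -/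
open scoped Classical

open SimpleGraph Matrix

noncomputable section

variable {V : Type*}

/-- `G` is the S-coalescence `⊛ᵢ (S i, v i)`: the vertices `v i` are identified into the single
vertex `vstar`, via the embeddings `g i : V i → W`. -/
structure IsSCoalescence {ι : Type*} {Vf : ι → Type*} [∀ i, Fintype (Vf i)]
    {W : Type*} [Fintype W]
    (S : ∀ i, SimpleGraph (Vf i)) (v : ∀ i, Vf i)
    (G : SimpleGraph W) (g : ∀ i, Vf i → W) (vstar : W) : Prop where
  map_v : ∀ i, g i (v i) = vstar
  inj : ∀ i, Function.Injective (g i)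
  disj : ∀ i j a b, i ≠ j → a ≠ v i → b ≠ v j → g i a ≠ g j b
  cover : ∀ w : W, ∃ i a, g i a = w
  adj_within : ∀ i a b, G.Adj (g i a) (g i b) ↔ (S i).Adj a b
  not_adj_across : ∀ i j a b, i ≠ j → a ≠ v i → b ≠ v j → ¬ G.Adj (g i a) (g j b)

namespace IsSCoalescence

variable {ι : Type*} {Vf : ι → Type*} [∀ i, Fintype (Vf i)] {W : Type*} [Fintype W]
  {S : ∀ i, SimpleGraph (Vf i)} {v : ∀ i, Vf i} {G : SimpleGraph W} {g : ∀ i, Vf i → W}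
  {vstar : W}

theorem eq_of_map_eq (h : IsSCoalescence S v G g vstar) {i j : ι} (hij : i ≠ j)
    {a : Vf i} {b : Vf j} (hab : g i a = g j b) : a = v i ∧ b = v j := by
  by_cases ha : a = v i
  · refine ⟨ha, h.inj j ?_⟩
    rw [← hab, ha, h.map_v, h.map_v]
  · by_cases hb : b = v j
    · refine ⟨h.inj i ?_, hb⟩
      rw [hab, hb, h.map_v, h.map_v]
    · exact absurd hab (h.disj i j a b hij ha hb)

theorem exists_of_adj (h : IsSCoalescence S v G g vstar) {x y : W} (hxy : G.Adj x y) :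
    ∃ i a b, g i a = x ∧ g i b = y ∧ (S i).Adj a b := by
  obtain ⟨i, a, rfl⟩ := h.cover x
  obtain ⟨j, b, rfl⟩ := h.cover y
  by_cases hij : i = j
  · subst hij
    exact ⟨i, a, b, rfl, rfl, (h.adj_within i a b).1 hxy⟩
  by_cases ha : a = v i
  · have hva : g j (v j) = g i a := by rw [ha, h.map_v, h.map_v]
    exact ⟨j, v j, b, hva, rfl, (h.adj_within j _ _).1 (hva ▸ hxy)⟩
  by_cases hb : b = v j
  · have hvb : g i (v i) = g j b := by rw [hb, h.map_v, h.map_v]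
    exact ⟨i, a, v i, rfl, hvb, (h.adj_within i _ _).1 (hvb ▸ hxy)⟩
  exact absurd hxy (h.not_adj_across i j a b hij ha hb)

theorem exists_retraction (h : IsSCoalescence S v G g vstar) (i : ι) :
    ∃ r : W → Vf i, (∀ a, r (g i a) = a) ∧ ∀ j b, i ≠ j → r (g j b) = v i := by
  refine ⟨Function.extend (g i) id fun _ => v i, fun a => (h.inj i).extend_apply _ _ a, ?_⟩
  intro j b hij
  by_cases hb : ∃ a, g i a = g j b
  · obtain ⟨a, ha⟩ := hb
    rw [← ha, (h.inj i).extend_apply]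
    exact (h.eq_of_map_eq hij ha).1
  · exact Function.extend_apply' _ _ _ hb

theorem connected [Nonempty ι] (h : IsSCoalescence S v G g vstar)
    (hS : ∀ i, (S i).Connected) : G.Connected := by
  have key : ∀ w, G.Reachable vstar w := by
    intro w
    obtain ⟨i, a, rfl⟩ := h.cover w
    rw [← h.map_v i]
    exact ((hS i).preconnected (v i) a).map ⟨g i, fun hab => (h.adj_within i _ _).2 hab⟩
  have : Nonempty W := ⟨vstar⟩
  exact ⟨fun x y => (key x).symm.trans (key y)⟩

theorem isAcyclic (h : IsSCoalescence S v G g vstar) (hS : ∀ i, (S i).IsAcyclic) :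
    G.IsAcyclic := by
  rw [isAcyclic_iff_forall_adj_isBridge]
  intro x y hxy
  obtain ⟨i, a, b, rfl, rfl, hab⟩ := h.exists_of_adj hxy
  obtain ⟨r, hr, hr'⟩ := h.exists_retraction i
  have hbr := isAcyclic_iff_forall_adj_isBridge.1 (hS i) hab
  rw [isBridge_iff] at hbr ⊢
  intro hreach
  apply hbr
  have key : ∀ x y, (G.deleteEdges {s(g i a, g i b)}).Reachable x y →
      ((S i).deleteEdges {s(a, b)}).Reachable (r x) (r y) := by
    rintro x y ⟨p⟩
    induction p with
    | nil => exact .refl _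
    | cons hadj _ ih =>
      refine Reachable.trans ?_ ih
      rw [deleteEdges_adj] at hadj
      obtain ⟨j, c, d, rfl, rfl, hcd⟩ := h.exists_of_adj hadj.1
      by_cases hij : i = j
      · subst hij
        rw [hr, hr]
        refine Adj.reachable ?_
        rw [deleteEdges_adj]
        refine ⟨hcd, fun hmem => hadj.2 ?_⟩
        exact congrArg (Sym2.map (g i)) hmem
      · rw [hr' j c hij, hr' j d hij]
  simpa only [hr] using key _ _ hreach

theorem exists_glue (h : IsSCoalescence S v G g vstar) {z : ∀ i, Vf i → ℝ} {c : ℝ}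
    (hz : ∀ i, z i (v i) = c) : ∃ y : W → ℝ, ∀ i a, y (g i a) = z i a := by
  have hcompat : ∀ j b i a, g j b = g i a → z j b = z i a := by
    intro j b i a hw
    by_cases hij : j = i
    · subst hij
      rw [h.inj j hw]
    · obtain ⟨hb, ha⟩ := h.eq_of_map_eq hij hw
      rw [hb, ha, hz, hz]
  choose f e hfe using h.cover
  exact ⟨fun w => z (f w) (e w), fun i a => hcompat _ _ i a (hfe _)⟩

theorem mulVec_eq_zero [Finite ι] (h : IsSCoalescence S v G g vstar) {z : ∀ i, Vf i → ℝ}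
    (hz : ∀ i, adjMat (S i) *ᵥ z i = 0) {y : W → ℝ} (hy : ∀ i a, y (g i a) = z i a) :
    adjMat G *ᵥ y = 0 := by
  have := Fintype.ofFinite ι
  choose r hr hr' using h.exists_retraction
  have hz' : ∀ i b, ∑ a, adjMat (S i) b a * z i a = 0 := fun i b => congrFun (hz i) b
  ext u
  change ∑ w, adjMat G u w * y w = 0
  by_cases hu : u = vstar
  · subst hu
    have hsplit : ∀ w, adjMat G u w * y w = ∑ i, adjMat (S i) (v i) (r i w) * y w := by
      intro w
      obtain ⟨j, b, rfl⟩ := h.cover w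
      rw [Finset.sum_eq_single j]
      · rw [hr, ← h.map_v j]
        simp [adjMat, h.adj_within]
      · intro i _ hij
        simp [adjMat, hr' i j b hij]
      · simp
    simp_rw [hsplit]
    rw [Finset.sum_comm]
    refine Finset.sum_eq_zero fun i _ => ?_
    rw [← hz' i (v i)]
    symm
    refine Fintype.sum_of_injective (g i) (h.inj i) _ _ ?_ ?_
    · intro w hw
      obtain ⟨j, b, rfl⟩ := h.cover w
      have hij : i ≠ j := by
        rintro rfl
        exact hw ⟨b, rfl⟩
      simp [adjMat, hr' i j b hij]
    · intro a
      rw [hr, hy]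
  · obtain ⟨i, b, rfl⟩ := h.cover u
    rw [← hz' i b]
    symm
    refine Fintype.sum_of_injective (g i) (h.inj i) _ _ ?_ ?_
    · intro w hw
      have hnadj : ¬ G.Adj (g i b) w := by
        intro hadj
        obtain ⟨j, c, d, hc, rfl, -⟩ := h.exists_of_adj hadj
        by_cases hij : i = j
        · subst hij
          exact hw ⟨d, rfl⟩
        · exact hu (by rw [(h.eq_of_map_eq hij hc.symm).1, h.map_v])
      simp [adjMat, hnadj]
    · intro a
      rw [hy]
      simp [adjMat, h.adj_within]

theorem map_mem_suppSet [Finite ι] (h : IsSCoalescence S v G g vstar)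
    (hv : ∀ i, v i ∈ suppSet (S i)) {i : ι} {a : Vf i} (ha : a ∈ suppSet (S i)) :
    g i a ∈ suppSet G := by
  obtain ⟨x, hx, hxa⟩ := ha
  choose t ht htv using hv
  have hex : ∀ j, ∃ z : Vf j → ℝ, adjMat (S j) *ᵥ z = 0 ∧ z (v j) = x (v i) ∧
      ∀ hij : i = j, z = hij ▸ x := by
    intro j
    by_cases hij : i = j
    · subst hij
      exact ⟨x, hx, rfl, fun _ => rfl⟩
    · refine ⟨(x (v i) / t j (v j)) • t j, ?_, ?_, fun h => absurd h hij⟩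
      · rw [mulVec_smul, ht, smul_zero]
      · simp [div_mul_cancel₀ _ (htv j)]
  choose z hz hzv hzi using hex
  obtain ⟨y, hy⟩ := h.exists_glue hzv
  refine ⟨y, h.mulVec_eq_zero hz hy, ?_⟩
  rw [hy, hzi i rfl]
  exact hxa

end IsSCoalescence

/-- The S-coalescence of S-trees `S₁,…,S_k` at supported vertices `vᵢ ∈ Supp(Sᵢ)` is again an
S-tree. -/
theorem stmt10 {k : ℕ} (hk : 0 < k) {Vf : Fin k → Type*} [∀ i, Fintype (Vf i)]
    {W : Type*} [Fintype W]
    (S : ∀ i, SimpleGraph (Vf i)) (v : ∀ i, Vf i)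
    (G : SimpleGraph W) (g : ∀ i, Vf i → W) (vstar : W)
    (hS : ∀ i, IsSTree (S i)) (hv : ∀ i, v i ∈ suppSet (S i))
    (hco : IsSCoalescence S v G g vstar) :
    IsSTree G := by
  have : Nonempty (Fin k) := ⟨⟨0, hk⟩⟩
  refine ⟨⟨hco.connected fun i => (hS i).1.connected,
    hco.isAcyclic fun i => (hS i).1.isAcyclic⟩, ?_⟩
  refine Set.eq_univ_of_forall fun w => ?_
  obtain ⟨i, a, rfl⟩ := hco.cover w
  have ha : a ∈ suppSet (S i) ∪ coreSet (S i) := (hS i).2 ▸ Set.mem_univ a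
  obtain ha | ⟨u, hu, hadj⟩ := ha
  · exact Or.inl (hco.map_mem_suppSet hv ha)
  · exact Or.inr ⟨g i u, hco.map_mem_suppSet hv hu, (hco.adj_within i u a).2 hadj⟩
end
end
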